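/- arXiv:2505.12922 — 3 statements merged into one kernel-verified Lean document; each statement's English description precedes it below -/
import Mathlib

section
/- For every free group F of infinite rank, the group Out(F) has trivial center. -/
open Pointwise

/-- A subset `S` of a free group is a basis if the canonical homomorphism
`FreeGroup S →* FreeGroup X` extending the inclusion is bijective. -/
def FreeGroup.IsBasis {X : Type*} (S : Set (FreeGroup X)) : Prop :=
  Function.Bijective (FreeGroup.lift (fun s : S => (s : FreeGroup X)))

/-- The subgroup of inner automorphisms of a group `G`, as a subgroup of `MulAut G`. -/
def Inn (G : Type*) [Group G] : Subgroup (MulAut G) :=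
  (MulAut.conj : G →* MulAut G).range

instance Inn.normal (G : Type*) [Group G] : (Inn G).Normal := by
  constructor
  rintro - ⟨g, rfl⟩ σ
  refine ⟨σ g, ?_⟩
  ext x
  simp [MulAut.conj, MulAut.mul_apply, mul_assoc]

/-- The outer automorphism group `Out G = Aut G / Inn G`. -/
abbrev OutAut (G : Type*) [Group G] := MulAut G ⧸ Inn G

/-- The natural homomorphism `Aut G → Out G`. -/
def toOut {G : Type*} [Group G] : MulAut G →* OutAut G :=
  QuotientGroup.mk' (Inn G)

/-- `g` is an involution of the group `G`. -/
def IsInvolution {G : Type*} [Group G] (g : G) : Prop :=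
  g ≠ 1 ∧ g ^ 2 = 1

/-- A subset of a group is anti-commutative if its elements pairwise do not commute. -/
def AntiCommSet {G : Type*} [Group G] (s : Set G) : Prop :=
  ∀ a ∈ s, ∀ b ∈ s, a ≠ b → a * b ≠ b * a

/-- A decomposition `U ⊔ S ⊔ ⊔_{x ∈ S} Y x` of a basis of a free group. -/
structure IsBasisDecomposition {X : Type*} (U S : Set (FreeGroup X))
    (Y : FreeGroup X → Set (FreeGroup X)) : Prop where
  isBasis : FreeGroup.IsBasis (U ∪ S ∪ ⋃ x ∈ S, Y x)
  disjUS : Disjoint U S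
  disjUY : ∀ x ∈ S, Disjoint U (Y x)
  disjSY : ∀ x ∈ S, Disjoint S (Y x)
  disjYY : ∀ x ∈ S, ∀ x' ∈ S, x ≠ x' → Disjoint (Y x) (Y x')

/-- `U ⊔ S ⊔ ⊔_{x ∈ S} Y x` is a canonical basis for the (soft) involution `φ`:
`φ` fixes `U` pointwise, inverts the elements of `S` and conjugates the elements of
`Y x` by `x`. -/
def IsCanonicalBasis {X : Type*} (φ : MulAut (FreeGroup X)) (U S : Set (FreeGroup X))
    (Y : FreeGroup X → Set (FreeGroup X)) : Prop :=
  IsBasisDecomposition U S Y ∧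
    (∀ u ∈ U, φ u = u) ∧ (∀ x ∈ S, φ x = x⁻¹) ∧
    (∀ x ∈ S, ∀ y ∈ Y x, φ y = x * y * x⁻¹)

/-- A soft involution of `Aut F`: an involution admitting a canonical basis. -/
def IsSoftInvolution {X : Type*} (φ : MulAut (FreeGroup X)) : Prop :=
  IsInvolution φ ∧ ∃ U S Y, IsCanonicalBasis φ U S Y

/-- A soft involution of `Out F`: an involution induced by a soft involution of `Aut F`. -/
def IsSoftOutInvolution {X : Type*} (f : OutAut (FreeGroup X)) : Prop :=
  IsInvolution f ∧ ∃ φ, IsSoftInvolution φ ∧ toOut φ = f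

/-- A `1`-involution of `Aut F`: a soft involution whose canonical bases have exactly
one block. -/
def IsOneInvolution {X : Type*} (ψ : MulAut (FreeGroup X)) : Prop :=
  IsInvolution ψ ∧ ∃ (U Y : Set (FreeGroup X)) (x : FreeGroup X),
    IsCanonicalBasis ψ U {x} (fun _ => Y)

/-- A `1`-involution of `Out F`: an involution induced by a `1`-involution of `Aut F`. -/
def IsOneOutInvolution {X : Type*} (f : OutAut (FreeGroup X)) : Prop :=
  IsInvolution f ∧ ∃ ψ, IsOneInvolution ψ ∧ toOut ψ = f

/-- An extremal involution of `Aut F`: an involution inverting one element of a suitable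
basis and fixing all other elements of that basis. -/
def IsExtremalInvolution {X : Type*} (φ : MulAut (FreeGroup X)) : Prop :=
  IsInvolution φ ∧ ∃ (B : Set (FreeGroup X)) (x : FreeGroup X),
    FreeGroup.IsBasis B ∧ x ∈ B ∧ φ x = x⁻¹ ∧ ∀ b ∈ B, b ≠ x → φ b = b

/-- An extremal involution of `Out F`: an involution induced by an extremal involution
of `Aut F`. -/
def IsExtremalOutInvolution {X : Type*} (f : OutAut (FreeGroup X)) : Prop :=
  IsInvolution f ∧ ∃ φ, IsExtremalInvolution φ ∧ toOut φ = f

/-- A symmetry of `Aut F`: an involution inverting all elements of some basis. -/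
def IsSymmetryAut {X : Type*} (θ : MulAut (FreeGroup X)) : Prop :=
  IsInvolution θ ∧ ∃ B : Set (FreeGroup X), FreeGroup.IsBasis B ∧ ∀ b ∈ B, θ b = b⁻¹

/-- A symmetry of `Out F`: an involution whose full preimage in `Aut F` contains a
symmetry. -/
def IsSymmetryOut {X : Type*} (f : OutAut (FreeGroup X)) : Prop :=
  IsInvolution f ∧ ∃ θ, IsSymmetryAut θ ∧ toOut θ = f

/-- Condition (★): the product set `K·K` contains exactly one conjugacy class of
involutions, and no element of `K` is a square. -/
def StarCondition {G : Type*} [Group G] (K : Set G) : Prop :=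
  (∃ c ∈ K * K, IsInvolution c ∧ ∀ d ∈ K * K, IsInvolution d → IsConj c d) ∧
    ∀ k ∈ K, ¬ ∃ g : G, g ^ 2 = k

namespace FreeGroup

variable {X : Type*}

/-- An element commuting with a generator is a power of that generator. -/
theorem mem_zpowers_of_commute_of {b : X} {g : FreeGroup X} (h : Commute g (of b)) :
    g ∈ Subgroup.zpowers (of b) := by
  classical
  induction hn : g.norm using Nat.strong_induction_on generalizing g with
  | _ n ih =>
  subst hn
  rcases hL : g.toWord with _ | ⟨⟨x, e⟩, L⟩
  · rw [toWord_eq_nil_iff.1 hL]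
    exact one_mem _
  have hred : IsReduced ((x, e) :: L) := hL ▸ isReduced_toWord
  have hg : g = mk [(x, e)] * mk L := by
    rw [mul_mk, List.singleton_append, ← hL, mk_toWord]
  have hword := congrArg toWord h.eq
  rw [toWord_mul, toWord_mul, toWord_of, hL] at hword
  by_cases hx : x = b
  · subst hx
    have hs : mk [(x, e)] ∈ Subgroup.zpowers (of x) := by
      cases e
      · exact inv_mem (Subgroup.mem_zpowers (of x))
      · exact Subgroup.mem_zpowers (of x)
    have hcomm : Commute (mk L) (of x) := by
      have : mk L = (mk [(x, e)])⁻¹ * g := by rw [hg]; group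
      rw [this]
      obtain ⟨k, hk⟩ := Subgroup.mem_zpowers_iff.1 hs
      rw [← hk]
      exact ((Commute.refl (of x)).zpow_left k).inv_left.mul_left h
    have hlt : (mk L).norm < g.norm := by
      refine lt_of_le_of_lt norm_mk_le ?_
      rw [norm, hL]
      simp
    rw [hg]
    exact mul_mem hs (ih _ hlt hcomm rfl)
  · exfalso
    have hred' : IsReduced ([(b, true)] ++ (x, e) :: L) := by
      simp only [List.singleton_append, IsReduced, List.isChain_cons_cons]
      exact ⟨fun h => absurd h.symm hx, hred⟩
    rw [hred'.reduce_eq] at hword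
    have hsub : Red ((x, e) :: L ++ [(b, true)]) ([(b, true)] ++ (x, e) :: L) :=
      hword ▸ reduce.red
    have := hsub.sublist.eq_of_length (by simp)
    simp at this
    exact hx this.1.1.symm

/-- Two endomorphisms agreeing on the finitely many letters of a word agree on it. -/
theorem exists_finset_support (w : FreeGroup X) :
    ∃ A : Finset X, ∀ f g : FreeGroup X →* FreeGroup X,
      (∀ x ∈ A, f (of x) = g (of x)) → f w = g w := by
  classical
  induction w using FreeGroup.induction_on with
  | C1 => exact ⟨∅, fun f g _ => by simp⟩
  | of x => exact ⟨{x}, fun f g h => h x (by simp)⟩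
  | inv_of x ih =>
    obtain ⟨A, hA⟩ := ih
    exact ⟨A, fun f g h => by simp only [_root_.map_inv, hA f g h]⟩
  | mul u v ihu ihv =>
    obtain ⟨A, hA⟩ := ihu
    obtain ⟨B, hB⟩ := ihv
    refine ⟨A ∪ B, fun f g h => ?_⟩
    rw [_root_.map_mul, _root_.map_mul, hA f g fun x hx => h x (Finset.mem_union_left _ hx),
      hB f g fun x hx => h x (Finset.mem_union_right _ hx)]

open Classical in
/-- The endomorphism sending the letters in `S` to `1` and fixing all other letters. -/
noncomputable def kill (S : Set X) : FreeGroup X →* FreeGroup X :=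
  lift fun x => if x ∈ S then 1 else of x

open Classical in
theorem kill_of (S : Set X) (x : X) : kill S (of x) = if x ∈ S then 1 else of x := by
  simp [kill]

theorem kill_compl_singleton_mem_zpowers (b : X) (w : FreeGroup X) :
    kill {b}ᶜ w ∈ Subgroup.zpowers (of b) := by
  classical
  have : (kill {b}ᶜ).range ≤ Subgroup.zpowers (of b) := by
    refine range_lift_le ?_
    rintro _ ⟨x, rfl⟩
    by_cases hx : x = b <;> simp [hx]
  exact this ⟨w, rfl⟩

open Classical in
/-- The endomorphism sending `b` to `c * b * c⁻¹` and fixing all other letters. -/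
noncomputable def conjLetterHom (b : X) (c : FreeGroup X) : FreeGroup X →* FreeGroup X :=
  lift fun x => if x = b then c * of b * c⁻¹ else of x

theorem conjLetterHom_self (b : X) (c : FreeGroup X) :
    conjLetterHom b c (of b) = c * of b * c⁻¹ := by
  simp [conjLetterHom]

theorem conjLetterHom_of_ne {b x : X} (h : x ≠ b) (c : FreeGroup X) :
    conjLetterHom b c (of x) = of x := by
  simp [conjLetterHom, h]

theorem conjLetterHom_comp {b : X} {c d : FreeGroup X} (hd : conjLetterHom b c d = d)
    (hcd : d * c = 1) : (conjLetterHom b c).comp (conjLetterHom b d) = MonoidHom.id _ := by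
  ext x
  by_cases hx : x = b
  · subst hx
    have : c = d⁻¹ := eq_inv_of_mul_eq_one_right hcd
    simp only [MonoidHom.comp_apply, conjLetterHom_self, _root_.map_mul, _root_.map_inv, hd, MonoidHom.id_apply]
    rw [this]
    group
  · simp [conjLetterHom_of_ne hx]

/-- The automorphism sending the letter `b` to `c * b * c⁻¹`, for a letter `c ≠ b`, and fixing
all letters other than `b`. -/
noncomputable def conjLetter {b c : X} (h : c ≠ b) : MulAut (FreeGroup X) :=
  MonoidHom.toMulEquiv (conjLetterHom b (of c)) (conjLetterHom b (of c)⁻¹)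
    (conjLetterHom_comp (by simp [conjLetterHom_of_ne h]) (by simp))
    (conjLetterHom_comp (by simp [conjLetterHom_of_ne h]) (by simp))

theorem conjLetter_apply {b c : X} (h : c ≠ b) (w : FreeGroup X) :
    conjLetter h w = conjLetterHom b (of c) w := rfl

theorem kill_conjLetter {b c : X} (h : c ≠ b) (w : FreeGroup X) :
    kill {b} (conjLetter h w) = kill {b} w := by
  have : (kill {b}).comp (conjLetterHom b (of c)) = kill {b} := by
    ext x
    by_cases hx : x = b
    · subst hx
      simp [conjLetterHom_self, kill_of]
    · simp [conjLetterHom_of_ne hx]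
  exact DFunLike.congr_fun this w

theorem eq_one_of_commute_of_of {x y : X} (hxy : x ≠ y) {g : FreeGroup X}
    (hx : Commute g (of x)) (hy : Commute g (of y)) : g = 1 := by
  obtain ⟨m, rfl⟩ := Subgroup.mem_zpowers_iff.1 (mem_zpowers_of_commute_of hx)
  obtain ⟨n, hn⟩ := Subgroup.mem_zpowers_iff.1 (mem_zpowers_of_commute_of hy)
  have := congrArg (kill {y}) hn
  simpa [kill_of, hxy] using this.symm

/-- An automorphism is central modulo inner automorphisms. -/
def IsOutCentral (σ : MulAut (FreeGroup X)) : Prop :=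
  ∀ τ : MulAut (FreeGroup X), ∃ g, ∀ w, σ (τ w) = g * τ (σ w) * g⁻¹

variable [Infinite X] {σ : MulAut (FreeGroup X)}

/-- If `σ` is central modulo inner automorphisms, then the conjugacy class of `σ (of b)` is not
changed by killing finitely many letters other than `b`. -/
theorem IsOutCentral.isConj_kill (hσ : IsOutCentral σ) (b : X) (S : Finset X) (hb : b ∉ S) :
    IsConj (σ (of b)) (kill (S : Set X) (σ (of b))) := by
  classical
  induction S using Finset.induction_on with
  | empty =>
    have : kill ((∅ : Finset X) : Set X) = MonoidHom.id _ := by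
      ext x
      simp [kill_of]
    rw [this]
    exact IsConj.refl _
  | insert x S hx ih =>
    simp only [Finset.mem_insert, not_or] at hb
    obtain ⟨A, hA⟩ := exists_finset_support (σ (of b))
    obtain ⟨z, hz⟩ := Infinite.exists_notMem_finset (A ∪ insert b (insert x S))
    simp only [Finset.mem_union, Finset.mem_insert, not_or] at hz
    obtain ⟨hzA, hzb, hzx, hzS⟩ := hz
    let π : MulAut (FreeGroup X) := freeGroupCongr (Equiv.swap x z)
    have hπ (y : X) : π (of y) = of (Equiv.swap x z y) := by simp [π]
    obtain ⟨g, hg⟩ := hσ π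
    have hw : IsConj (π (σ (of b))) (σ (of b)) := by
      refine isConj_iff.2 ⟨g, ?_⟩
      rw [← hg, hπ, Equiv.swap_apply_of_ne_of_ne hb.1 (Ne.symm hzb)]
    have hkill : kill ((insert x S : Finset X) : Set X) (π (σ (of b))) =
        π (kill (S : Set X) (σ (of b))) := by
      refine hA ((kill _).comp π.toMonoidHom) (π.toMonoidHom.comp (kill _)) fun y hy => ?_
      have hyz : y ≠ z := fun h => hzA (h ▸ hy)
      by_cases hyx : y = x
      · subst hyx
        simp [hπ, kill_of, hx, hzx, hzS]
      · by_cases hyS : y ∈ S <;>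
          simp [hπ, kill_of, Equiv.swap_apply_of_ne_of_ne hyx hyz, hyx, hyS]
    have h₁ := (kill ((insert x S : Finset X) : Set X)).map_isConj hw
    rw [hkill] at h₁
    exact hw.symm.trans ((π.toMonoidHom.map_isConj (ih hb.2)).trans h₁)

theorem IsOutCentral.exists_eq_conj_zpow (hσ : IsOutCentral σ) (b : X) :
    ∃ (u : FreeGroup X) (n : ℤ), σ (of b) = u * of b ^ n * u⁻¹ := by
  classical
  obtain ⟨A, hA⟩ := exists_finset_support (σ (of b))
  have hconj := hσ.isConj_kill b (A.erase b) (by simp)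
  have hkill : kill ((A.erase b : Finset X) : Set X) (σ (of b)) = kill {b}ᶜ (σ (of b)) := by
    refine hA _ _ fun y hy => ?_
    by_cases hyb : y = b <;> simp [kill_of, hyb, hy]
  obtain ⟨n, hn⟩ := Subgroup.mem_zpowers_iff.1 (kill_compl_singleton_mem_zpowers b (σ (of b)))
  rw [hkill, ← hn] at hconj
  obtain ⟨u, hu⟩ := isConj_iff.1 hconj.symm
  exact ⟨u, n, hu.symm⟩

/-- An automorphism central modulo inner automorphisms is, on any finite set of letters containing
two given letters, conjugation by some element. -/
theorem IsOutCentral.exists_conj_on_finset (hσ : IsOutCentral σ) {x y : X} (hxy : x ≠ y)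
    (C : Finset X) (hx : x ∈ C) (hy : y ∈ C) :
    ∃ v, ∀ c ∈ C, σ (of c) = v * of c * v⁻¹ := by
  classical
  choose A hA using fun c : X => exists_finset_support (σ (of c))
  obtain ⟨b, hb⟩ := Infinite.exists_notMem_finset (C ∪ C.biUnion A)
  simp only [Finset.mem_union, Finset.mem_biUnion, not_or, not_exists, not_and] at hb
  obtain ⟨hbC, hbA⟩ := hb
  have hne {c : X} (hc : c ∈ C) : c ≠ b := fun h => hbC (h ▸ hc)
  obtain ⟨u, n, hu⟩ := hσ.exists_eq_conj_zpow b
  have hr : ∀ c ∈ C, kill {b} (σ (of c)) = σ (of c) := fun c hc =>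
    hA c (kill {b}) (MonoidHom.id _) fun z hz => by
      have : z ≠ b := fun h => hbA c hc (h ▸ hz)
      simp [kill_of, this]
  refine ⟨kill {b} u, fun c hc => ?_⟩
  obtain ⟨g, hg⟩ := hσ (conjLetter (hne hc))
  have hτ : ∀ d ∈ C, conjLetter (hne hc) (σ (of d)) = σ (of d) := fun d hd =>
    hA d (conjLetterHom b (of c)) (MonoidHom.id _) fun z hz => by
      have : z ≠ b := fun h => hbA d hd (h ▸ hz)
      simp [conjLetterHom_of_ne this]
  have hcomm : ∀ d ∈ C, Commute (σ.symm g) (of d) := fun d hd => by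
    have h₁ := hg (of d)
    rw [hτ d hd, conjLetter_apply, conjLetterHom_of_ne (hne hd)] at h₁
    have h₂ : Commute g (σ (of d)) := (mul_inv_eq_iff_eq_mul.1 h₁.symm)
    simpa using h₂.map σ.symm
  have hg1 : g = 1 := by
    simpa using eq_one_of_commute_of_of hxy (hcomm x hx) (hcomm y hy)
  subst hg1
  have h₁ := hg (of b)
  rw [conjLetter_apply, conjLetterHom_self, _root_.map_mul, _root_.map_mul, _root_.map_inv, hu, _root_.map_mul, _root_.map_mul,
    _root_.map_inv, _root_.map_zpow, conjLetter_apply _ (of b), conjLetterHom_self, conj_zpow] at h₁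
  set τ := conjLetter (hne hc)
  let t := (τ u * of c)⁻¹ * (σ (of c) * u)
  have ht : t * of b ^ n * t⁻¹ = of b ^ n := by
    have : t * of b ^ n * t⁻¹ = (τ u * of c)⁻¹ *
        (σ (of c) * (u * of b ^ n * u⁻¹) * (σ (of c))⁻¹) * (τ u * of c) := by
      simp only [t]; group
    rw [this, h₁]
    group
  obtain ⟨s, hs⟩ := σ.surjective u⁻¹
  obtain ⟨t', ht'⟩ := σ.surjective t
  have hbn : of b ^ n = σ (s * of b * s⁻¹) := by
    rw [_root_.map_mul, _root_.map_mul, _root_.map_inv, hs, hu]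
    group
  have hcomm' : Commute (s⁻¹ * t' * s) (of b) := by
    rw [hbn, ← ht', ← _root_.map_inv, ← _root_.map_mul, ← _root_.map_mul] at ht
    have h₂ := mul_inv_eq_iff_eq_mul.1 (σ.injective ht)
    have h₃ := congrArg (fun z => s⁻¹ * z * s) h₂
    simpa [Commute, SemiconjBy, mul_assoc] using h₃
  obtain ⟨j, hj⟩ := Subgroup.mem_zpowers_iff.1 (mem_zpowers_of_commute_of hcomm')
  have htj : t = (of b ^ n) ^ j := by
    rw [hbn, ← _root_.map_zpow, conj_zpow, hj, ← ht']
    congr 1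
    group
  have hkt : kill {b} t = 1 := by
    rw [htj]
    simp [kill_of]
  simp only [t, _root_.map_mul, _root_.map_inv, hr c hc, τ, kill_conjLetter] at hkt
  rw [inv_mul_eq_one, kill_of, if_neg (by simpa using hne hc)] at hkt
  rw [hkt]
  group

theorem IsOutCentral.mem_inn (hσ : IsOutCentral σ) : σ ∈ Inn (FreeGroup X) := by
  classical
  obtain ⟨x, y, hxy⟩ := exists_pair_ne X
  obtain ⟨v, hv⟩ := hσ.exists_conj_on_finset hxy {x, y} (by simp) (by simp)
  refine ⟨v, MulEquiv.toMonoidHom_injective (FreeGroup.ext_hom _ _ fun z => ?_)⟩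
  obtain ⟨v', hv'⟩ := hσ.exists_conj_on_finset hxy {x, y, z} (by simp) (by simp)
  have hcomm : ∀ c ∈ ({x, y} : Finset X), Commute (v⁻¹ * v') (of c) := fun c hc => by
    have h := (hv c hc).symm.trans (hv' c (by simp at hc ⊢; tauto))
    have h' := congrArg (fun w => v⁻¹ * w * v') h
    simpa [Commute, SemiconjBy, mul_assoc] using h'.symm
  have hvv : v = v' := inv_mul_eq_one.1
    (eq_one_of_commute_of_of hxy (hcomm x (by simp)) (hcomm y (by simp)))
  simp [hvv, hv' z (by simp)]

end FreeGroup

/-- For every free group `F` of infinite rank, the group `Out F` has trivial center. -/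
theorem outAut_center_trivial (X : Type*) [Infinite X] :
    Subgroup.center (OutAut (FreeGroup X)) = ⊥ := by
  rw [eq_bot_iff]
  intro f hf
  obtain ⟨σ, rfl⟩ := QuotientGroup.mk_surjective f
  rw [Subgroup.mem_bot, QuotientGroup.eq_one_iff]
  refine FreeGroup.IsOutCentral.mem_inn fun τ => ?_
  have h := Subgroup.mem_center_iff.1 hf (τ : OutAut (FreeGroup X))
  rw [← QuotientGroup.mk_mul, ← QuotientGroup.mk_mul, eq_comm, QuotientGroup.eq_iff_div_mem] at h
  obtain ⟨g, hg⟩ := h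
  refine ⟨g, fun w => ?_⟩
  rw [eq_div_iff_mul_eq'] at hg
  simpa using (DFunLike.congr_fun hg w).symm
end

section
/- Let φ be a soft involution of Aut(F), let B be a canonical basis for φ, and let X = X(B) be the set of elements of B inverted by φ. An element s ∈ Out(F) commutes with φ̂ if and only if there is σ ∈ Aut(F) in the preimage of s such that either σφ = φσ, or σφ = τ_x φ σ for a suitable x ∈ X. -/
open Pointwise

namespace Monoid.CoprodI

variable {ι : Type*} {G : ι → Type*} [∀ i, Group (G i)]

theorem NeWord.prod_ne_one {i j : ι} (w : NeWord G i j) : w.prod ≠ 1 := by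
  classical
  intro h
  have h' : w.toWord = Word.empty :=
    Word.equiv.symm.injective (by simpa [NeWord.prod, Word.equiv] using h)
  exact w.toList_ne_nil (congrArg Word.toList h')

theorem NeWord.length_toList_inv {i j : ι} (w : NeWord G i j) :
    w.inv.toList.length = w.toList.length := by
  induction w with
  | singleton => simp [NeWord.inv]
  | append _ _ _ h₁ h₂ => simp [NeWord.inv, h₁, h₂, add_comm]

/-- A nonempty reduced word is either a single letter, or splits off its first letter. -/
theorem NeWord.eq_of_head_or_exists_tail {i j : ι} (w : NeWord G i j) :
    (i = j ∧ w.prod = of w.head ∧ w.toList.length = 1) ∨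
      ∃ (k : ι) (_ : i ≠ k) (w' : NeWord G k j),
        w.prod = of w.head * w'.prod ∧ w.toList.length = w'.toList.length + 1 := by
  induction w with
  | singleton x hx => exact Or.inl ⟨rfl, by simp, by simp⟩
  | @append i j k l w₁ hne w₂ ih₁ _ =>
    right
    rcases ih₁ with ⟨rfl, h, hl⟩ | ⟨m, hm, w', hw', hl⟩
    · exact ⟨k, hne, w₂, by simp [h], by simp [hl, add_comm]⟩
    · exact ⟨m, hm, .append w' hne w₂, by
        rw [NeWord.append_prod, NeWord.append_prod, NeWord.append_head, hw', mul_assoc], by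
        simp only [NeWord.toList, List.length_append] at hl ⊢; omega⟩

theorem NeWord.fst_eq_of_prod_sq_eq_one {i j : ι} (w : NeWord G i j) (h : w.prod ^ 2 = 1) :
    i = j := by
  by_contra hij
  exact (NeWord.append w (Ne.symm hij) w).prod_ne_one (by rw [NeWord.append_prod, ← sq, h])

theorem NeWord.exists_conj_of_prod_sq_eq_one {i j : ι} (w : NeWord G i j)
    (h : w.prod ^ 2 = 1) : ∃ (g : CoprodI G) (k : ι) (x : G k), w.prod = g * of x * g⁻¹ := by
  induction hn : w.toList.length using Nat.strong_induction_on generalizing i j with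
  | _ n ih =>
  obtain rfl := w.fst_eq_of_prod_sq_eq_one h
  rcases w.eq_of_head_or_exists_tail with ⟨-, h₁, -⟩ | ⟨k, hik, w', hw', hl⟩
  · exact ⟨1, i, w.head, by simp [h₁]⟩
  have hconj : (of w.head⁻¹ * w'.inv.prod) = (of w.head)⁻¹ * w.prod⁻¹ * of w.head := by
    rw [hw', NeWord.inv_prod, map_inv]; group
  have hsq : (of w.head⁻¹ * w'.inv.prod) ^ 2 = 1 := by
    rw [hconj, sq]
    calc _ = (of w.head)⁻¹ * (w.prod ^ 2)⁻¹ * of w.head := by group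
      _ = 1 := by rw [h]; group
  by_cases hx : w.head⁻¹ * w'.inv.head = 1
  · rcases w'.inv.eq_of_head_or_exists_tail with ⟨h₁, -⟩ | ⟨l, -, w₂, hw₂, hl₂⟩
    · exact absurd h₁ hik
    have hp : of w.head⁻¹ * w'.inv.prod = w₂.prod := by
      rw [hw₂, ← mul_assoc, ← map_mul, hx, map_one, one_mul]
    rw [w'.length_toList_inv] at hl₂
    obtain ⟨g, m, y, hy⟩ := ih w₂.toList.length (by omega) w₂ (hp ▸ hsq) rfl
    refine ⟨of w.head * g, m, y⁻¹, ?_⟩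
    have : w.prod = of w.head * (w₂.prod)⁻¹ * (of w.head)⁻¹ := by rw [← hp, hconj]; group
    rw [this, hy, map_inv]; group
  · exact absurd ((w'.inv.mulHead w.head⁻¹ hx).fst_eq_of_prod_sq_eq_one
      (by rw [NeWord.mulHead_prod, hsq])) hik

/-- An involution of a free product is conjugate to an element of one of the factors. -/
theorem exists_conj_of_sq_eq_one {p : CoprodI G} (hp : p ≠ 1) (h : p ^ 2 = 1) :
    ∃ (g : CoprodI G) (k : ι) (x : G k), p = g * of x * g⁻¹ := by
  classical
  have hprod : (Word.equiv p).prod = p := Word.equiv.symm_apply_apply p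
  obtain ⟨i, j, w, hw⟩ := NeWord.of_word (Word.equiv p) (by
    intro h0
    rw [h0, Word.prod_empty] at hprod
    exact hp hprod.symm)
  have hwp : w.prod = p := by rw [NeWord.prod, hw, hprod]
  rw [← hwp] at h ⊢
  exact w.exists_conj_of_prod_sq_eq_one h

end Monoid.CoprodI

theorem FreeGroup.conj_injective {X : Type*} [Infinite X] :
    Function.Injective (MulAut.conj : FreeGroup X →* MulAut (FreeGroup X)) := by
  classical
  rw [injective_iff_map_eq_one]
  intro z hz
  obtain ⟨a, ha⟩ := Infinite.exists_notMem_finset (z.toWord.map Prod.fst).toFinset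
  have hcomm : of a * z = z * of a := by
    have h := DFunLike.congr_fun hz (of a)
    rw [MulAut.conj_apply, MulAut.one_apply, mul_inv_eq_iff_eq_mul] at h
    exact h.symm
  have hmem : (a, true) ∉ z.toWord := fun h => ha (by simpa using Or.inr h)
  have hleft : (of a * z).toWord = (a, true) :: z.toWord := by
    rw [toWord_mul, toWord_of, List.singleton_append, reduce.cons, reduce_toWord]
    rcases h : z.toWord with _ | ⟨⟨b, c⟩, L⟩
    · rfl
    · have hb : a ≠ b := by rintro rfl; exact ha (by simp [h])
      simp [hb]
  have hsub : ((a, true) :: z.toWord).Sublist (z.toWord ++ [(a, true)]) := by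
    rw [← hleft, hcomm, toWord_mul, toWord_of]
    exact reduce.red.sublist
  have heq := hsub.eq_of_length (by simp)
  rcases h : z.toWord with _ | ⟨b, L⟩
  · exact toWord_eq_nil_iff.mp h
  · rw [h, List.cons_append, List.cons.injEq] at heq
    exact absurd (by simp [h, heq.1]) hmem

theorem MulAut.mul_conj {G : Type*} [Group G] (φ : MulAut G) (g : G) :
    φ * MulAut.conj g = MulAut.conj (φ g) * φ := by
  ext; simp

/-- The involution `τ_{x⁻¹} φ` attached to `x`, with `φ` itself attached to `none`. -/
def blockInvolution {G : Type*} [Group G] (φ : MulAut G) (S : Set G) : Option S → MulAut G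
  | none => φ
  | some x => (MulAut.conj (x : G))⁻¹ * φ

/-- The centralizer of a block involution in the group generated by `Inn G` and `φ`. -/
def blockGroup {G : Type*} [Group G] (φ : MulAut G) (S : Set G) (i : Option S) :
    Subgroup (MulAut G) :=
  (Inn G ⊔ Subgroup.zpowers φ) ⊓ Subgroup.centralizer {blockInvolution φ S i}

section Block

variable {G : Type*} [Group G] {φ : MulAut G} {S : Set G}

theorem conj_mem_sup (g : G) : MulAut.conj g ∈ Inn G ⊔ Subgroup.zpowers φ :=
  Subgroup.mem_sup_left ⟨g, rfl⟩

theorem self_mem_sup : φ ∈ Inn G ⊔ Subgroup.zpowers φ :=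
  Subgroup.mem_sup_right (Subgroup.mem_zpowers φ)

theorem exists_conj_of_mem_sup (h2 : φ ^ 2 = 1) {g : MulAut G}
    (hg : g ∈ Inn G ⊔ Subgroup.zpowers φ) :
    ∃ v : G, g = MulAut.conj v ∨ g = MulAut.conj v * φ := by
  obtain ⟨_, ⟨v, rfl⟩, _, ⟨n, rfl⟩, rfl⟩ := Subgroup.mem_sup_of_normal_left.mp hg
  refine ⟨v, ?_⟩
  have h2' : φ ^ (2 : ℤ) = 1 := by exact_mod_cast h2
  rcases Int.even_or_odd' n with ⟨k, rfl | rfl⟩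
  · left; simp [zpow_mul, h2']
  · right; simp [zpow_add, zpow_mul, h2']

theorem blockInvolution_mem_sup (i : Option S) :
    blockInvolution φ S i ∈ Inn G ⊔ Subgroup.zpowers φ := by
  rcases i with _ | x
  · exact self_mem_sup
  · exact mul_mem (inv_mem (conj_mem_sup _)) self_mem_sup

theorem blockInvolution_mem (i : Option S) : blockInvolution φ S i ∈ blockGroup φ S i :=
  ⟨blockInvolution_mem_sup i, by simp [Subgroup.mem_centralizer_singleton_iff]⟩

theorem conj_mem_blockGroup {i : Option S} {g : G} (h : blockInvolution φ S i g = g) :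
    MulAut.conj g ∈ blockGroup φ S i :=
  ⟨conj_mem_sup g, by
    refine Subgroup.mem_centralizer_singleton_iff.mpr ?_
    rw [MulAut.mul_conj, h]⟩

theorem blockInvolution_sq (h2 : φ ^ 2 = 1) (hS : ∀ x ∈ S, φ x = x⁻¹) (i : Option S) :
    blockInvolution φ S i * blockInvolution φ S i = 1 := by
  rw [sq] at h2
  rcases i with _ | ⟨x, hx⟩
  · exact h2
  · change (MulAut.conj x)⁻¹ * φ * ((MulAut.conj x)⁻¹ * φ) = 1
    rw [← map_inv, mul_assoc, ← mul_assoc φ, MulAut.mul_conj, map_inv φ, hS x hx, inv_inv,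
      mul_assoc, h2, mul_one, map_inv, inv_mul_cancel]

theorem exists_conj_mul_blockInvolution (h2 : φ ^ 2 = 1) (i : Option S) {g : MulAut G}
    (hg : g ∈ Inn G ⊔ Subgroup.zpowers φ) :
    ∃ v : G, g = MulAut.conj v ∨ g = MulAut.conj v * blockInvolution φ S i := by
  obtain ⟨v, rfl | rfl⟩ := exists_conj_of_mem_sup h2 hg
  · exact ⟨v, Or.inl rfl⟩
  · rcases i with _ | x
    · exact ⟨v, Or.inr rfl⟩
    · exact ⟨v * x, Or.inr (by simp [blockInvolution, mul_assoc])⟩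

/-- In a torsion-free group with trivial centre, the block involution is the only involution
in its block group. -/
theorem eq_blockInvolution_of_sq_eq_one [IsMulTorsionFree G]
    (hinj : Function.Injective (MulAut.conj : G →* MulAut G)) (h2 : φ ^ 2 = 1)
    (hS : ∀ x ∈ S, φ x = x⁻¹) {i : Option S} {g : MulAut G} (hg : g ∈ blockGroup φ S i)
    (hg1 : g ≠ 1) (hg2 : g * g = 1) : g = blockInvolution φ S i := by
  have hconj : ∀ v : G, MulAut.conj v * MulAut.conj v = 1 → v = 1 := fun v hv => by
    rw [← map_mul, ← sq, ← map_one MulAut.conj] at hv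
    exact (pow_eq_one_iff_left two_ne_zero).mp (hinj hv)
  obtain ⟨v, rfl | rfl⟩ := exists_conj_mul_blockInvolution h2 i hg.1
  · exact absurd (by rw [hconj v hg2, map_one]) hg1
  · have hc := Subgroup.mem_centralizer_singleton_iff.mp hg.2
    have ht := blockInvolution_sq h2 hS i
    have hv : MulAut.conj v * MulAut.conj v = 1 := by
      rw [mul_assoc, ht, mul_one, ← mul_assoc] at hc
      calc MulAut.conj v * MulAut.conj v
          = MulAut.conj v * blockInvolution φ S i * (MulAut.conj v * blockInvolution φ S i) := by
            nth_rewrite 2 [hc]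
            simp only [mul_assoc]
        _ = 1 := hg2
    rw [hconj v hv, map_one, one_mul]

end Block

section Canonical

variable {X : Type*} {φ : MulAut (FreeGroup X)} {U S : Set (FreeGroup X)}
  {Y : FreeGroup X → Set (FreeGroup X)}

open Monoid (CoprodI)

/-- The inclusion of a block group into the free product of the block groups. -/
def blockOf (φ : MulAut (FreeGroup X)) (S : Set (FreeGroup X)) (i : Option S) :
    blockGroup φ S i →* CoprodI (fun i => blockGroup φ S i) :=
  CoprodI.of (M := fun i => blockGroup φ S i)

/-- The block involution, as an element of the free product of the block groups. -/
def blockGen (φ : MulAut (FreeGroup X)) (S : Set (FreeGroup X)) (i : Option S) :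
    CoprodI (fun i => blockGroup φ S i) :=
  blockOf φ S i ⟨blockInvolution φ S i, blockInvolution_mem i⟩

/-- The natural map from the free product of the block groups to the automorphism group. -/
def blockLift (φ : MulAut (FreeGroup X)) (S : Set (FreeGroup X)) :
    CoprodI (fun i => blockGroup φ S i) →* MulAut (FreeGroup X) :=
  CoprodI.lift fun i => (blockGroup φ S i).subtype

theorem blockLift_blockGen (i : Option S) :
    blockLift φ S (blockGen φ S i) = blockInvolution φ S i := by
  simp [blockLift, blockGen, blockOf]

theorem blockGen_mul_self (h2 : φ ^ 2 = 1) (hS : ∀ x ∈ S, φ x = x⁻¹) (i : Option S) :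
    blockGen φ S i * blockGen φ S i = 1 := by
  rw [blockGen, ← map_mul, ← map_one (blockOf φ S i)]
  exact congrArg _ (Subtype.ext (blockInvolution_sq h2 hS i))

theorem blockLift_mem_sup (p : CoprodI (fun i => blockGroup φ S i)) :
    blockLift φ S p ∈ Inn (FreeGroup X) ⊔ Subgroup.zpowers φ := by
  refine CoprodI.lift_range_le _ _ (fun i => ?_) ⟨p, rfl⟩
  rw [Subgroup.range_subtype]
  exact inf_le_left

theorem FreeGroup.IsBasis.monoidHom_ext {B : Set (FreeGroup X)} (hB : FreeGroup.IsBasis B)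
    {H : Type*} [Group H] {f g : FreeGroup X →* H} (h : ∀ b ∈ B, f b = g b) : f = g := by
  have : f.comp (FreeGroup.lift (fun s : B => (s : FreeGroup X))) =
      g.comp (FreeGroup.lift (fun s : B => (s : FreeGroup X))) := by
    ext b
    simpa using h b b.2
  exact (MonoidHom.cancel_right hB.2).mp this

theorem FreeGroup.IsBasis.exists_monoidHom {B : Set (FreeGroup X)} (hB : FreeGroup.IsBasis B)
    {H : Type*} [Group H] (f : FreeGroup X → H) :
    ∃ F : FreeGroup X →* H, ∀ b ∈ B, F b = f b := by
  let e := MulEquiv.ofBijective _ hB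
  refine ⟨(FreeGroup.lift fun b : B => f b).comp e.symm.toMonoidHom, fun b hb => ?_⟩
  have : e.symm b = FreeGroup.of ⟨b, hb⟩ := by
    rw [MulEquiv.symm_apply_eq]
    exact (FreeGroup.lift_apply_of (f := fun s : B => (s : FreeGroup X)) (x := ⟨b, hb⟩)).symm
  simp [this]

/-- The free group maps to the free product of the block groups, so that `φ` is induced by
conjugation by the generator of the trivial block. -/
theorem IsCanonicalBasis.exists_toCoprodI (hB : IsCanonicalBasis φ U S Y) (h2 : φ ^ 2 = 1) :
    ∃ α : FreeGroup X →* CoprodI (fun i => blockGroup φ S i),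
      (∀ w, blockLift φ S (α w) = MulAut.conj w) ∧
      ∀ w, α (φ w) = blockGen φ S none * α w * (blockGen φ S none)⁻¹ := by
  obtain ⟨hdec, hU, hS, hY⟩ := hB
  have hUfix : ∀ u ∈ U, MulAut.conj u ∈ blockGroup φ S none := fun u hu =>
    conj_mem_blockGroup (hU u hu)
  have hYfix : ∀ (x : S), ∀ y ∈ Y x, MulAut.conj y ∈ blockGroup φ S (some x) := fun x y hy =>
    conj_mem_blockGroup (by
      simp [blockInvolution, ← map_inv, hY x x.2 y hy, mul_assoc])
  have hex : ∀ b : FreeGroup X, ∃ p : CoprodI (fun i => blockGroup φ S i),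
      (∀ h : b ∈ U, p = blockOf φ S none ⟨_, hUfix b h⟩) ∧
      (∀ h : b ∈ S, p = blockGen φ S none * blockGen φ S (some ⟨b, h⟩)) ∧
      (∀ (x : S) (h : b ∈ Y x), p = blockOf φ S (some x) ⟨_, hYfix x b h⟩) := by
    intro b
    by_cases hbU : b ∈ U
    · exact ⟨blockOf φ S none ⟨_, hUfix b hbU⟩, fun _ => rfl,
        fun h => (Set.disjoint_left.mp hdec.disjUS hbU h).elim,
        fun x h => (Set.disjoint_left.mp (hdec.disjUY x x.2) hbU h).elim⟩
    by_cases hbS : b ∈ S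
    · exact ⟨blockGen φ S none * blockGen φ S (some ⟨b, hbS⟩), fun h => (hbU h).elim, fun _ => rfl,
        fun x h => (Set.disjoint_left.mp (hdec.disjSY x x.2) hbS h).elim⟩
    by_cases hbY : ∃ x : S, b ∈ Y x
    · obtain ⟨x, hx⟩ := hbY
      refine ⟨blockOf φ S (some x) ⟨_, hYfix x b hx⟩, fun h => (hbU h).elim,
        fun h => (hbS h).elim, fun x' h => ?_⟩
      obtain rfl : x = x' := by
        by_contra hne
        exact Set.disjoint_left.mp (hdec.disjYY x x.2 x' x'.2 (by simpa [Subtype.ext_iff] using hne))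
          hx h
      rfl
    · exact ⟨1, fun h => (hbU h).elim, fun h => (hbS h).elim, fun x h => (hbY ⟨x, h⟩).elim⟩
  choose f hfU hfS hfY using hex
  obtain ⟨α, hα⟩ := hdec.isBasis.exists_monoidHom f
  have hαU : ∀ u (h : u ∈ U), α u = blockOf φ S none ⟨_, hUfix u h⟩ :=
    fun u h => (hα u (Or.inl (Or.inl h))).trans (hfU u h)
  have hαS : ∀ x (h : x ∈ S), α x = blockGen φ S none * blockGen φ S (some ⟨x, h⟩) :=
    fun x h => (hα x (Or.inl (Or.inr h))).trans (hfS x h)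
  have hαY : ∀ (x : S) y (h : y ∈ Y x),
      α y = blockOf φ S (some x) ⟨_, hYfix x y h⟩ :=
    fun x y h => (hα y (Or.inr (Set.mem_biUnion x.2 h))).trans (hfY y x h)
  have hsq := blockGen_mul_self h2 hS
  have hinv : ∀ i, (blockGen φ S i)⁻¹ = blockGen φ S i := fun i => inv_eq_of_mul_eq_one_left (hsq i)
  have hcomm : ∀ (i : Option S) (g : blockGroup φ S i),
      blockGen φ S i * blockOf φ S i g = blockOf φ S i g * blockGen φ S i := fun i g => by
    rw [blockGen, ← map_mul, ← map_mul]
    exact congrArg _ (Subtype.ext (Subgroup.mem_centralizer_singleton_iff.mp g.2.2).symm)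
  refine ⟨α, fun w => ?_, fun w => ?_⟩
  · refine DFunLike.congr_fun (f := (blockLift φ S).comp α) (g := MulAut.conj) ?_ w
    refine hdec.isBasis.monoidHom_ext fun b hb => ?_
    rw [MonoidHom.comp_apply]
    rcases hb with (hb | hb) | hb
    · rw [hαU b hb]; simp [blockLift, blockOf]
    · rw [hαS b hb, map_mul, blockLift_blockGen, blockLift_blockGen]
      change φ * ((MulAut.conj b)⁻¹ * φ) = _
      rw [← mul_assoc, ← map_inv, MulAut.mul_conj, mul_assoc, ← sq, h2, mul_one, map_inv, hS b hb,
        inv_inv]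
    · obtain ⟨x, hx, hy⟩ := Set.mem_iUnion₂.mp hb
      rw [hαY ⟨x, hx⟩ b hy]; simp [blockLift, blockOf]
  · refine DFunLike.congr_fun (f := α.comp φ.toMonoidHom)
      (g := (MulAut.conj (blockGen φ S none)).toMonoidHom.comp α) ?_ w
    refine hdec.isBasis.monoidHom_ext fun b hb => ?_
    change α (φ b) = blockGen φ S none * α b * (blockGen φ S none)⁻¹
    rcases hb with (hb | hb) | hb
    · rw [hU b hb, hαU b hb, hcomm, mul_inv_cancel_right]
    · rw [hS b hb, map_inv, hαS b hb, mul_inv_rev, hinv, hinv, ← mul_assoc, hsq, one_mul]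
    · obtain ⟨x, hx, hy⟩ := Set.mem_iUnion₂.mp hb
      rw [hY x hx b hy, map_mul, map_mul, map_inv, hαS x hx, hαY ⟨x, hx⟩ b hy,
        mul_assoc (blockGen φ S none), hcomm]
      group

/-- The involutions `τ_w φ` are conjugate, by inner automorphisms, to `φ` or to some `τ_x φ`. -/
theorem IsCanonicalBasis.exists_conj_eq [Infinite X] (hB : IsCanonicalBasis φ U S Y)
    (h2 : φ ^ 2 = 1) {w : FreeGroup X} (hne : MulAut.conj w * φ ≠ 1)
    (hsq : (MulAut.conj w * φ) ^ 2 = 1) :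
    ∃ v : FreeGroup X, MulAut.conj w * φ = MulAut.conj v * φ * (MulAut.conj v)⁻¹ ∨
      ∃ x ∈ S, MulAut.conj w * φ = MulAut.conj v * (MulAut.conj x * φ) * (MulAut.conj v)⁻¹ := by
  have hS := hB.2.2.1
  obtain ⟨α, hα, hαφ⟩ := hB.exists_toCoprodI h2
  have hw : w * φ w = 1 := FreeGroup.conj_injective (by
    rw [map_one, map_mul, ← hsq, sq, mul_assoc, ← mul_assoc φ, MulAut.mul_conj φ, mul_assoc, ← sq,
      h2, mul_one])
  set c := blockGen φ S none with hc
  have hcc : c * c = 1 := blockGen_mul_self h2 hS none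
  have hlift : blockLift φ S (α w * c) = MulAut.conj w * φ := by
    rw [map_mul, hα, hc, blockLift_blockGen]; rfl
  have hp2 : (α w * c) ^ 2 = 1 := by
    calc (α w * c) ^ 2 = α w * (c * α w * c⁻¹) * (c * c) := by rw [sq]; group
      _ = 1 := by rw [← hαφ, ← map_mul, hw, hcc, map_one, one_mul]
  have hp1 : α w * c ≠ 1 := fun h => hne (by rw [← hlift, h, map_one])
  obtain ⟨g, i, k, hk⟩ := CoprodI.exists_conj_of_sq_eq_one hp1 hp2
  have hlift' : MulAut.conj w * φ = blockLift φ S g * k * (blockLift φ S g)⁻¹ := by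
    rw [← hlift, hk]; simp [blockLift]
  have hk' : (k : MulAut (FreeGroup X)) = blockInvolution φ S i := by
    refine eq_blockInvolution_of_sq_eq_one FreeGroup.conj_injective h2 hS k.2 (fun h => ?_) ?_
    · rw [h, mul_one, mul_inv_cancel] at hlift'
      exact hne hlift'
    · rw [hlift', sq] at hsq
      have : blockLift φ S g * (k * k) * (blockLift φ S g)⁻¹ = 1 := by rw [← hsq]; group
      rwa [mul_inv_eq_one, mul_eq_left] at this
  obtain ⟨v, hv⟩ : ∃ v, MulAut.conj w * φ =
      MulAut.conj v * blockInvolution φ S i * (MulAut.conj v)⁻¹ := by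
    obtain ⟨v, hv | hv⟩ := exists_conj_mul_blockInvolution h2 i (blockLift_mem_sup g)
    · exact ⟨v, by rw [hlift', hk', hv]⟩
    · exact ⟨v, by rw [hlift', hk', hv]; group⟩
  rcases i with _ | ⟨x, hx⟩
  · exact ⟨v, Or.inl hv⟩
  · refine ⟨v * x⁻¹, Or.inr ⟨x, hx, hv.trans ?_⟩⟩
    have hxφ : φ * MulAut.conj x = (MulAut.conj x)⁻¹ * φ := by
      rw [MulAut.mul_conj, hS x hx, map_inv]
    change MulAut.conj v * ((MulAut.conj x)⁻¹ * φ) * (MulAut.conj v)⁻¹ = _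
    rw [← hxφ, map_mul, map_inv]
    group

end Canonical

/-- Let `φ` be a soft involution of `Aut F` with canonical basis `U ⊔ S ⊔ ⊔_{x ∈ S} Y x`.
An element `s ∈ Out F` commutes with `φ̂` iff some preimage `σ ∈ Aut F` of `s` satisfies
either `σφ = φσ` or `σφ = τ_x φ σ` for a suitable `x ∈ S`. -/
theorem commuting_with_soft_involution (X : Type*) [Infinite X]
    (φ : MulAut (FreeGroup X)) (hφ : IsSoftInvolution φ)
    (U S : Set (FreeGroup X)) (Y : FreeGroup X → Set (FreeGroup X))
    (hB : IsCanonicalBasis φ U S Y)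
    (s : OutAut (FreeGroup X)) :
    s * toOut φ = toOut φ * s ↔
      ∃ σ : MulAut (FreeGroup X), toOut σ = s ∧
        (σ * φ = φ * σ ∨ ∃ x ∈ S, σ * φ = MulAut.conj x * φ * σ) := by
  have h2 : φ ^ 2 = 1 := hφ.1.2
  have hinn : ∀ g : FreeGroup X, toOut (MulAut.conj g) = 1 := fun g =>
    (QuotientGroup.eq_one_iff _).mpr ⟨g, rfl⟩
  constructor
  · intro hs
    obtain ⟨σ, rfl⟩ := QuotientGroup.mk'_surjective (Inn (FreeGroup X)) s
    change toOut σ * toOut φ = toOut φ * toOut σ at hs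
    have hmem : toOut (σ * φ * σ⁻¹ * φ⁻¹) = 1 := by
      rw [map_mul, map_mul, map_mul, map_inv, map_inv, hs]; group
    obtain ⟨w, hw⟩ := (QuotientGroup.eq_one_iff _).mp hmem
    have hwφ : MulAut.conj w * φ = σ * φ * σ⁻¹ := by rw [hw]; group
    obtain ⟨v, hv⟩ := hB.exists_conj_eq h2 (w := w)
      (by rw [hwφ]; exact fun h => hφ.1.1 (conj_eq_one_iff.mp h))
      (by rw [hwφ, conj_pow, h2]; group)
    rw [hwφ] at hv
    have hσ : ∀ θ : MulAut (FreeGroup X), σ * φ * σ⁻¹ = MulAut.conj v * θ * (MulAut.conj v)⁻¹ →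
        (MulAut.conj v)⁻¹ * σ * φ = θ * ((MulAut.conj v)⁻¹ * σ) := fun θ h => by
      rw [mul_inv_eq_iff_eq_mul] at h
      rw [mul_assoc, h]; group
    refine ⟨(MulAut.conj v)⁻¹ * σ, ?_, ?_⟩
    · rw [map_mul, map_inv, hinn, inv_one, one_mul]; rfl
    · exact hv.imp (hσ _) fun ⟨x, hx, h⟩ => ⟨x, hx, hσ _ h⟩
  · rintro ⟨σ, rfl, h | ⟨x, -, h⟩⟩
    · rw [← map_mul, h, map_mul]
    · rw [← map_mul, h, map_mul, map_mul, hinn, one_mul]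
end

section
/- Let φ be a soft involution of Aut(F), let B be a canonical basis for φ, and let X = X(B) be the set of elements of B inverted by φ. If for all x ∈ X the involutions φ and τ_x φ are not conjugate in Aut(F), then for every s ∈ Out(F) which commutes with φ̂ there is a preimage σ ∈ Aut(F) of s which commutes with φ. -/
open Pointwise

/-- An element of a free product of groups whose square is trivial is trivial or conjugate to an
element of one of the factors. -/
theorem Monoid.CoprodI.eq_one_or_isConj_of_of_sq_eq_one {ι : Type*} {G : ι → Type*}
    [∀ i, Group (G i)] (g : Monoid.CoprodI G) (hg : g ^ 2 = 1) :
    g = 1 ∨ ∃ (i : ι) (m : G i), IsConj (Monoid.CoprodI.of m) g := by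
  classical
  suffices key : ∀ l : List (Σ i, G i), (∀ a ∈ l, a.2 ≠ 1) →
      l.IsChain (fun a b => a.1 ≠ b.1) →
      (l.map fun a => (Monoid.CoprodI.of a.2 : Monoid.CoprodI G)).prod ^ 2 = 1 →
      (l.map fun a => (Monoid.CoprodI.of a.2 : Monoid.CoprodI G)).prod = 1 ∨
        ∃ (i : ι) (m : G i), IsConj (Monoid.CoprodI.of m)
          (l.map fun a => (Monoid.CoprodI.of a.2 : Monoid.CoprodI G)).prod by
    obtain ⟨w, rfl⟩ := Monoid.CoprodI.Word.equiv.symm.surjective g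
    exact key w.toList w.ne_one w.chain_ne hg
  intro l
  induction l using List.bidirectionalRec with
  | nil => simp
  | singleton a => exact fun _ _ _ => .inr ⟨a.1, a.2, by rw [List.map_singleton, List.prod_singleton]⟩
  | cons_append a l b ih =>
    intro hne hch hsq
    -- the inverse of a reduced word is the reversed word of inverses
    have hinv : (a :: (l ++ [b])) =
        ((a :: (l ++ [b])).map fun c => (⟨c.1, c.2⁻¹⟩ : Σ i, G i)).reverse := by
      set L := a :: (l ++ [b])
      have hprod : ∀ L : List (Σ i, G i),
          (((L.map fun c => (⟨c.1, c.2⁻¹⟩ : Σ i, G i)).reverse).map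
            fun a => (Monoid.CoprodI.of a.2 : Monoid.CoprodI G)).prod =
          (L.map fun a => (Monoid.CoprodI.of a.2 : Monoid.CoprodI G)).prod⁻¹ := by
        intro L
        induction L with
        | nil => simp
        | cons c L ih => simp_all
      let w : Monoid.CoprodI.Word G := ⟨L, hne, hch⟩
      let w' : Monoid.CoprodI.Word G :=
        ⟨(L.map fun c => (⟨c.1, c.2⁻¹⟩ : Σ i, G i)).reverse, by
          simp only [List.mem_reverse, List.mem_map]
          rintro _ ⟨c, hc, rfl⟩
          exact inv_ne_one.mpr (hne c hc), by
          rw [List.isChain_reverse, List.isChain_map]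
          exact hch.imp fun _ _ h => h.symm⟩
      have hww : w = w' := by
        apply Monoid.CoprodI.Word.equiv.symm.injective
        change w.prod = w'.prod
        refine Eq.trans ?_ (hprod L).symm
        rw [eq_inv_iff_mul_eq_one, ← hsq, sq]
        rfl
      exact congrArg Monoid.CoprodI.Word.toList hww
    have hb : b = ⟨a.1, a.2⁻¹⟩ := by
      rw [List.map_cons, List.reverse_cons, ← List.cons_append] at hinv
      simpa using (List.append_inj' hinv rfl).2
    subst hb
    have hmem : ∀ c ∈ l, c.2 ≠ 1 := fun c hc => hne c (by simp [hc])
    have hchl : l.IsChain (fun a b => a.1 ≠ b.1) :=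
      hch.infix ⟨[a], [⟨a.1, a.2⁻¹⟩], by simp⟩
    have hconj : IsConj (l.map fun a => (Monoid.CoprodI.of a.2 : Monoid.CoprodI G)).prod
        ((a :: (l ++ [⟨a.1, a.2⁻¹⟩])).map
          fun a => (Monoid.CoprodI.of a.2 : Monoid.CoprodI G)).prod :=
      isConj_iff.mpr ⟨Monoid.CoprodI.of a.2, by simp [mul_assoc]⟩
    have hsql : (l.map fun a => (Monoid.CoprodI.of a.2 : Monoid.CoprodI G)).prod ^ 2 = 1 := by
      have := hconj.pow 2
      rw [hsq] at this
      exact isConj_one_left.mp this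
    rcases ih hmem hchl hsql with h | ⟨i, m, h⟩
    · rw [h] at hconj
      exact .inl (isConj_one_right.mp hconj)
    · exact .inr ⟨i, m, h.trans hconj⟩

/-- The center of a free group of infinite rank is trivial. -/
theorem FreeGroup.eq_one_of_forall_commute {X : Type*} [Infinite X] (c : FreeGroup X)
    (hc : ∀ w, c * w = w * c) : c = 1 := by
  classical
  obtain ⟨x, hx⟩ := Infinite.exists_notMem_finset (c.toWord.map Prod.fst).toFinset
  have hx' : ∀ p ∈ c.toWord, p.1 ≠ x := by
    rintro p hp rfl
    exact hx (List.mem_toFinset.mpr (List.mem_map_of_mem hp))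
  have hred : FreeGroup.IsReduced c.toWord := FreeGroup.isReduced_toWord
  have h1 : FreeGroup.IsReduced (c.toWord ++ [(x, true)]) := by
    refine List.IsChain.append hred (List.isChain_singleton _) ?_
    intro p hp q hq hpq
    obtain rfl : (x, true) = q := by simpa using hq
    exact absurd hpq (hx' p (List.mem_of_getLast? hp))
  have h2 : FreeGroup.IsReduced ([(x, true)] ++ c.toWord) := by
    refine List.IsChain.append (List.isChain_singleton _) hred ?_
    intro p hp q hq hpq
    obtain rfl : (x, true) = p := by simpa using hp
    exact absurd hpq.symm (hx' q (List.mem_of_head? hq))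
  have h3 : FreeGroup.mk (c.toWord ++ [(x, true)]) = FreeGroup.mk ([(x, true)] ++ c.toWord) := by
    rw [← FreeGroup.mul_mk, ← FreeGroup.mul_mk, FreeGroup.mk_toWord]
    exact hc _
  have h4 : c.toWord ++ [(x, true)] = [(x, true)] ++ c.toWord := by
    rw [← h1.reduce_eq, ← h2.reduce_eq, ← FreeGroup.toWord_mk, ← FreeGroup.toWord_mk, h3]
  rcases hw : c.toWord with - | ⟨p, l⟩
  · exact FreeGroup.toWord_eq_nil_iff.mp hw
  · rw [hw] at h4 hx'
    simp only [List.cons_append, List.nil_append, List.cons.injEq] at h4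
    exact absurd (congrArg Prod.fst h4.1) (hx' p (by simp))

/-- Two homomorphisms which agree on a basis are equal. -/
theorem FreeGroup.IsBasis.hom_ext {X H : Type*} [Group H] {B : Set (FreeGroup X)}
    (hB : FreeGroup.IsBasis B) {f g : FreeGroup X →* H} (h : ∀ b ∈ B, f b = g b) : f = g := by
  have hcomp : f.comp (FreeGroup.lift fun s : B => (s : FreeGroup X)) =
      g.comp (FreeGroup.lift fun s : B => (s : FreeGroup X)) := by
    ext b
    simpa using h b b.2
  ext1 x
  obtain ⟨v, hv⟩ := hB.2 (FreeGroup.of x)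
  rw [← hv]
  exact DFunLike.congr_fun hcomp v

/-- A map from a basis to a group extends to a homomorphism. -/
theorem FreeGroup.IsBasis.exists_hom {X H : Type*} [Group H] {B : Set (FreeGroup X)}
    (hB : FreeGroup.IsBasis B) (f : B → H) :
    ∃ F : FreeGroup X →* H, ∀ b : B, F b = f b := by
  let e := MulEquiv.ofBijective _ hB
  refine ⟨(FreeGroup.lift f).comp e.symm.toMonoidHom, fun b => ?_⟩
  have : e.symm b = FreeGroup.of b := by
    rw [MulEquiv.symm_apply_eq]
    exact (FreeGroup.lift_apply_of).symm
  simp [this]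

theorem toOut_conj {G : Type*} [Group G] (g : G) : toOut (MulAut.conj g) = 1 :=
  (QuotientGroup.eq_one_iff _).mpr ⟨g, rfl⟩

theorem eq_one_or_eq_of_mem_zpowers_of_sq_eq_one {G : Type*} [Group G] {g h : G}
    (hg : g * g = 1) (hh : h ∈ Subgroup.zpowers g) : h = 1 ∨ h = g := by
  obtain ⟨k, rfl⟩ := Subgroup.mem_zpowers_iff.mp hh
  rcases Int.even_or_odd' k with ⟨n, rfl | rfl⟩
  · left
    rw [zpow_mul, zpow_two, hg, one_zpow]
  · right
    rw [zpow_add, zpow_mul, zpow_two, hg, one_zpow, one_mul, zpow_one]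

/-- If `φ` inverts `a`, then `τ_a φ` is trivial or conjugate, by an automorphism whose outer
class is a power of that of `φ`, to `φ` or to some `φ τ_x` where `x` is an element of the canonical
basis inverted by `φ`. -/
theorem IsCanonicalBasis.conj_mul_eq {X : Type*} {φ : MulAut (FreeGroup X)}
    (hφ : φ * φ = 1) {U S : Set (FreeGroup X)} {Y : FreeGroup X → Set (FreeGroup X)}
    (hB : IsCanonicalBasis φ U S Y) {a : FreeGroup X} (ha : φ a = a⁻¹) :
    MulAut.conj a * φ = 1 ∨
      ∃ h : MulAut (FreeGroup X), toOut h ∈ Subgroup.zpowers (toOut φ) ∧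
        ∃ p : FreeGroup X, (p = 1 ∨ p ∈ S) ∧
          MulAut.conj a * φ = h * (φ * MulAut.conj p) * h⁻¹ := by
  classical
  obtain ⟨hD, hU, hS, hY⟩ := hB
  -- The group generated by `φ` and the inner automorphisms is the free product of the groups
  -- `⟨φ τ_p⟩ × ⟨Z⟩`, where `(p, Z)` is `(1, U)` or `(x, Y x)` with `x ∈ S`.
  let Z : Option S → Set (FreeGroup X) := fun i => i.elim U fun x => Y x
  let p : Option S → FreeGroup X := fun i => i.elim 1 fun x => x
  have hp : ∀ i, φ (p i) = (p i)⁻¹ := by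
    rintro (- | x)
    · simp [p]
    · exact hS x x.2
  have hZ : ∀ i, ∀ z ∈ Z i, φ z = p i * z * (p i)⁻¹ := by
    rintro (- | x) z hz
    · simpa [p] using hU z hz
    · exact hY x x.2 z hz
  let ψ : Option S → MulAut (FreeGroup X) := fun i => φ * MulAut.conj (p i)
  have hψ : ∀ i, ψ i * ψ i = 1 := by
    intro i
    calc ψ i * ψ i = MulAut.conj (p i)⁻¹ * φ * (φ * MulAut.conj (p i)) := by
          rw [← hp, ← MulAut.mul_conj]
      _ = 1 := by
        rw [mul_assoc, ← mul_assoc φ, hφ, one_mul, ← map_mul, inv_mul_cancel, map_one]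
  have hψ_conj : ∀ i, ∀ z ∈ Z i, Commute (ψ i) (MulAut.conj z) := by
    intro i z hz
    have h1 : ψ i z = z := by
      simp only [ψ, MulAut.mul_apply, MulAut.conj_apply, map_mul, map_inv, hp, hZ i z hz]
      group
    have := MulAut.mul_conj (ψ i) z
    rwa [h1] at this
  let G : Option S → Type _ := fun i => Subgroup.zpowers (ψ i) × FreeGroup (Z i)
  let conjZ : ∀ i, FreeGroup (Z i) →* MulAut (FreeGroup X) :=
    fun i => MulAut.conj.comp (FreeGroup.lift fun z : Z i => (z : FreeGroup X))
  have hcomm : ∀ i, ∀ (m : Subgroup.zpowers (ψ i)) (n : FreeGroup (Z i)),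
      Commute ((Subgroup.zpowers (ψ i)).subtype m) (conjZ i n) := by
    rintro i ⟨m, hm⟩ n
    obtain ⟨k, rfl⟩ := Subgroup.mem_zpowers_iff.mp hm
    refine Commute.zpow_left ?_ k
    induction n using FreeGroup.induction_on with
    | C1 => simp
    | of z => simpa [conjZ] using hψ_conj i z z.2
    | inv_of z ih => simpa using ih
    | mul v w hv hw => simpa using hv.mul_right hw
  let Ψ : Monoid.CoprodI G →* MulAut (FreeGroup X) := Monoid.CoprodI.lift fun i =>
    (Subgroup.zpowers (ψ i)).subtype.noncommCoprod (conjZ i) (hcomm i)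
  have hΨ : ∀ i (m : G i), Ψ (Monoid.CoprodI.of m) = (m.1 : MulAut (FreeGroup X)) * conjZ i m.2 :=
    fun i m => Monoid.CoprodI.lift_of _ m
  let t : Option S → Monoid.CoprodI G := fun i =>
    Monoid.CoprodI.of (i := i) ((⟨ψ i, Subgroup.mem_zpowers _⟩, 1) : G i)
  let ζ : ∀ i, Z i → Monoid.CoprodI G := fun i z =>
    Monoid.CoprodI.of (i := i) ((1, FreeGroup.of z) : G i)
  have ht : ∀ i, t i * t i = 1 := by
    intro i
    have : (((⟨ψ i, Subgroup.mem_zpowers _⟩, 1) : G i) * (⟨ψ i, Subgroup.mem_zpowers _⟩, 1)) = 1 :=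
      Prod.ext (Subtype.ext (hψ i)) (one_mul _)
    rw [← map_mul, this, map_one]
  have htζ : ∀ i z, t i * ζ i z = ζ i z * t i := by
    intro i z
    simp only [t, ζ, ← map_mul]
    congr 1
  have hΨt : ∀ i, Ψ (t i) = ψ i := fun i => by simp [t, hΨ]
  have hΨζ : ∀ i z, Ψ (ζ i z) = MulAut.conj (z : FreeGroup X) := fun i z => by
    simp [ζ, hΨ, conjZ]
  have hψ_none : ψ none = φ := by simp [ψ, p]
  -- the embedding of the free group into the free product
  have hex : ∀ b : ↥(U ∪ S ∪ ⋃ x ∈ S, Y x), ∃ g : Monoid.CoprodI G,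
      (∃ i, ∃ h : (b : FreeGroup X) ∈ Z i, g = ζ i ⟨b, h⟩) ∨
        ∃ h : (b : FreeGroup X) ∈ S, g = t none * t (some ⟨b, h⟩) := by
    rintro ⟨b, (hb | hb) | hb⟩
    · exact ⟨_, .inl ⟨none, hb, rfl⟩⟩
    · exact ⟨_, .inr ⟨hb, rfl⟩⟩
    · obtain ⟨x, hx, hb⟩ := Set.mem_iUnion₂.mp hb
      exact ⟨_, .inl ⟨some ⟨x, hx⟩, hb, rfl⟩⟩
  choose f hf using hex
  obtain ⟨E, hE⟩ := hD.isBasis.exists_hom f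
  have hES : ∀ x (hx : x ∈ S), E x = t none * t (some ⟨x, hx⟩) := by
    intro x hx
    have hmem : x ∈ U ∪ S ∪ ⋃ x ∈ S, Y x := .inl (.inr hx)
    rw [hE ⟨x, hmem⟩]
    rcases hf ⟨x, hmem⟩ with ⟨- | y, h, -⟩ | ⟨h, h'⟩
    · exact (Set.disjoint_left.mp hD.disjUS h hx).elim
    · exact (Set.disjoint_left.mp (hD.disjSY y y.2) hx h).elim
    · exact h'
  have hEp : ∀ i, E (p i) = t none * t i := by
    rintro (- | x)
    · simp [p, ht]
    · exact hES x x.2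
  have hEb : ∀ b ∈ U ∪ S ∪ ⋃ x ∈ S, Y x,
      (∃ i, ∃ h : b ∈ Z i, E b = ζ i ⟨b, h⟩) ∨ b ∈ S := by
    intro b hb
    rcases hf ⟨b, hb⟩ with ⟨i, h, h'⟩ | ⟨h, -⟩
    · exact .inl ⟨i, h, (hE ⟨b, hb⟩).trans h'⟩
    · exact .inr h
  have htinv : ∀ i, (t i)⁻¹ = t i := fun i => inv_eq_of_mul_eq_one_left (ht i)
  have hEφ : E.comp φ.toMonoidHom = (MulAut.conj (t none)).toMonoidHom.comp E := by
    refine hD.isBasis.hom_ext fun b hb => ?_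
    simp only [MonoidHom.comp_apply, MulEquiv.toMonoidHom_eq_coe, MonoidHom.coe_coe,
      MulAut.conj_apply]
    rcases hEb b hb with ⟨i, h, hEi⟩ | h
    · rw [hZ i b h, map_mul, map_mul, map_inv, hEp, hEi, mul_assoc (t none), htζ]
      simp [mul_assoc]
    · rw [hS b h, map_inv, hES b h, mul_inv_rev, htinv, htinv, ← mul_assoc (t none), ht, one_mul]
  have hΨE : Ψ.comp E = MulAut.conj := by
    refine hD.isBasis.hom_ext fun b hb => ?_
    rw [MonoidHom.comp_apply]
    rcases hEb b hb with ⟨i, h, hEi⟩ | h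
    · rw [hEi, hΨζ]
    · rw [hES b h, map_mul, hΨt, hΨt, hψ_none, ← mul_assoc, hφ, one_mul]
      rfl
  have hΨg : Ψ (E a * t none) = MulAut.conj a * φ := by
    rw [map_mul, hΨt, hψ_none, ← hΨE, MonoidHom.comp_apply]
  have hsq : (E a * t none) ^ 2 = 1 := by
    have h1 : E (φ a) = t none * E a * (t none)⁻¹ := DFunLike.congr_fun hEφ a
    rw [ha, map_inv, htinv] at h1
    rw [sq, mul_assoc, ← mul_assoc (t none), ← h1, mul_inv_cancel]
  rcases Monoid.CoprodI.eq_one_or_isConj_of_of_sq_eq_one _ hsq with h | ⟨i, m, h⟩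
  · left
    rw [← hΨg, h, map_one]
  obtain ⟨c, hc⟩ := isConj_iff.mp h
  have hm : m ^ 2 = 1 := by
    have := h.pow 2
    rw [hsq, isConj_one_left, ← map_pow] at this
    exact Monoid.CoprodI.of_injective i (this.trans (map_one _).symm)
  have hm2 : m.2 = 1 := by
    have : m.2 ^ 2 = 1 := congrArg Prod.snd hm
    exact (pow_eq_one_iff_left two_ne_zero).mp this
  have hmul : MulAut.conj a * φ = Ψ c * (m.1 : MulAut (FreeGroup X)) * (Ψ c)⁻¹ := by
    rw [← hΨg, ← hc, map_mul, map_mul, map_inv, hΨ, hm2, map_one, mul_one]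
  rcases eq_one_or_eq_of_mem_zpowers_of_sq_eq_one (hψ i) m.1.2 with h | h
  · left
    rw [hmul, h, mul_one, mul_inv_cancel]
  · right
    refine ⟨Ψ c, ?_, p i, ?_, by rw [hmul, h]⟩
    · have hle : Ψ.range ≤ (Subgroup.zpowers (toOut φ)).comap toOut := by
        refine Monoid.CoprodI.lift_range_le _ _ fun j => ?_
        rintro _ ⟨n, rfl⟩
        rw [Subgroup.mem_comap, MonoidHom.noncommCoprod_apply, map_mul]
        refine mul_mem ?_ ?_
        · obtain ⟨k, hk⟩ := Subgroup.mem_zpowers_iff.mp n.1.2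
          rw [Subgroup.subtype_apply, ← hk, map_zpow]
          refine zpow_mem ?_ k
          simp only [ψ, map_mul, toOut_conj, mul_one]
          exact Subgroup.mem_zpowers _
        · simp only [conjZ, MonoidHom.comp_apply, toOut_conj]
          exact one_mem _
      exact hle ⟨c, rfl⟩
    · rcases i with - | x
      · exact .inl rfl
      · exact .inr x.2

/-- Let `φ` be a soft involution of `Aut F` with canonical basis `U ⊔ S ⊔ ⊔_{x ∈ S} Y x`.
If for all `x ∈ S` the involutions `φ` and `τ_x φ` are not conjugate in `Aut F`, then every
`s ∈ Out F` commuting with `φ̂` has a preimage `σ ∈ Aut F` commuting with `φ`. -/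
theorem commuting_preimage_of_soft_involution (X : Type*) [Infinite X]
    (φ : MulAut (FreeGroup X)) (hφ : IsSoftInvolution φ)
    (U S : Set (FreeGroup X)) (Y : FreeGroup X → Set (FreeGroup X))
    (hB : IsCanonicalBasis φ U S Y)
    (hnc : ∀ x ∈ S, ¬ IsConj φ (MulAut.conj x * φ))
    (s : OutAut (FreeGroup X)) (hs : s * toOut φ = toOut φ * s) :
    ∃ σ : MulAut (FreeGroup X), toOut σ = s ∧ σ * φ = φ * σ := by
  have hφ2 : φ * φ = 1 := by rw [← sq, hφ.1.2]
  obtain ⟨σ, rfl⟩ := QuotientGroup.mk'_surjective (Inn (FreeGroup X)) s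
  change toOut σ * toOut φ = toOut φ * toOut σ at hs
  change ∃ σ' : MulAut (FreeGroup X), toOut σ' = toOut σ ∧ σ' * φ = φ * σ'
  obtain ⟨a, ha⟩ : σ * φ * σ⁻¹ * φ⁻¹ ∈ Inn (FreeGroup X) := by
    refine (QuotientGroup.eq_one_iff _).mp ?_
    change toOut (σ * φ * σ⁻¹ * φ⁻¹) = 1
    rw [map_mul, map_mul, map_mul, hs, map_inv, map_inv]
    group
  have hσ : MulAut.conj a * φ = σ * φ * σ⁻¹ := by
    rw [ha, inv_mul_cancel_right]
  have hinv : φ a = a⁻¹ := by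
    have h1 : MulAut.conj (a * φ a) = 1 := by
      calc MulAut.conj (a * φ a) = MulAut.conj a * (MulAut.conj (φ a) * φ) * φ := by
            rw [mul_assoc, mul_assoc, hφ2, mul_one, map_mul]
        _ = (MulAut.conj a * φ) * (MulAut.conj a * φ) := by
            rw [← MulAut.mul_conj]
            simp only [mul_assoc]
        _ = σ * (φ * φ) * σ⁻¹ := by rw [hσ]; group
        _ = 1 := by rw [hφ2, mul_one, mul_inv_cancel]
    refine eq_inv_of_mul_eq_one_right (FreeGroup.eq_one_of_forall_commute _ fun w => ?_)
    exact mul_inv_eq_iff_eq_mul.mp (DFunLike.congr_fun h1 w)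
  rcases hB.conj_mul_eq hφ2 hinv with h | ⟨h, hh, p, rfl | hp, hc⟩
  · rw [hσ, mul_inv_eq_one, mul_eq_left] at h
    exact absurd h hφ.1.1
  · obtain ⟨k, hk⟩ := Subgroup.mem_zpowers_iff.mp hh
    rw [map_one, mul_one, hσ] at hc
    have hcomm : Commute (h⁻¹ * σ) φ := by
      calc h⁻¹ * σ * φ = h⁻¹ * (σ * φ * σ⁻¹) * σ := by group
        _ = φ * (h⁻¹ * σ) := by rw [hc]; group
    refine ⟨φ ^ k * (h⁻¹ * σ), ?_, ((Commute.refl φ).zpow_left k).mul_left hcomm⟩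
    rw [map_mul, map_zpow, hk, map_mul, map_inv, mul_inv_cancel_left]
  · have h1 : IsConj φ (MulAut.conj a * φ) := isConj_iff.mpr ⟨σ, hσ.symm⟩
    have h2 : IsConj (φ * MulAut.conj p) (MulAut.conj a * φ) := isConj_iff.mpr ⟨h, hc.symm⟩
    have h3 : IsConj (φ * MulAut.conj p) (MulAut.conj p * φ) :=
      isConj_iff.mpr ⟨MulAut.conj p, by group⟩
    exact absurd ((h1.trans h2.symm).trans h3) (hnc p hp)
end
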